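/- Let 0 < κ ≤ 1/12 and 0 ≤ a < 1. There exist C_a > 0 and λ₀ > 0 (depending only on κ and a) such that for all 0 < λ ≤ λ₀ and every η with λ^{2+4κ} ≤ η ≤ λ², one has sup_{α ∈ ℝ} ∫_{𝕋³} dp / |α − ω(p) + iη|^{2−a} ≤ C_a λ^{−2(1−a)}. -/

import Mathlib

open MeasureTheory Filter Topology

noncomputable section

/-- The torus `𝕋³ = [-1/2, 1/2]³` realized as a box in `ℝ³`. -/
def T3 : Set (Fin 3 → ℝ) := Set.pi Set.univ fun _ => Set.Icc (-(1/2) : ℝ) (1/2)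

/-- The lattice dispersion relation `e(p) = ∑_j (1 - cos(2π p_j))`. -/
def edisp (p : Fin 3 → ℝ) : ℝ := ∑ j, (1 - Real.cos (2 * Real.pi * p j))

/-- `Θ_ε(α) = ∫_{𝕋³} dq / (α - e(q) + iε)`. -/
def ThetaEps (ε α : ℝ) : ℂ := ∫ q in T3, ((α : ℂ) - (edisp q : ℂ) + (ε : ℂ) * Complex.I)⁻¹

/-- `Θ` is the limit of `Θ_ε` as `ε → 0⁺`. -/
def IsThetaLimit (Θ : ℝ → ℂ) : Prop :=
  ∀ α : ℝ, Tendsto (fun ε => ThetaEps ε α) (𝓝[>] (0 : ℝ)) (𝓝 (Θ α))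

/-- The renormalized dispersion `ω(p) = e(p) + λ² Θ(e(p))`. -/
def omegaR (Θ : ℝ → ℂ) (lam : ℝ) (p : Fin 3 → ℝ) : ℂ :=
  (edisp p : ℂ) + (lam : ℂ) ^ 2 * Θ (edisp p)

/-- A function on `𝕋³`, i.e. a `ℤ³`-periodic function on `ℝ³`. -/
def ZPeriodic (g : (Fin 3 → ℝ) → ℂ) : Prop :=
  ∀ (p : Fin 3 → ℝ) (n : Fin 3 → ℤ), g (p + fun j => (n j : ℝ)) = g p

/-- The `C¹` norm `‖g‖_∞ + ‖∇g‖_∞`. -/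
def C1Norm (g : (Fin 3 → ℝ) → ℂ) : ℝ :=
  (⨆ p : Fin 3 → ℝ, ‖g p‖) + ⨆ p : Fin 3 → ℝ, ‖fderiv ℝ g p‖

/-- `|||α||| = min {|α|, |α-2|, |α-3|, |α-4|, |α-6|}`. -/
def anorm (a : ℝ) : ℝ := min (min (min |a| |a - 2|) (min |a - 3| |a - 4|)) |a - 6|

/-- Distance between two points of the circle `ℝ/ℤ`. -/
def cdist (x y : ℝ) : ℝ := |x - y - (round (x - y) : ℝ)|

/-- `|||q||| = η + min {dist(q, γ) : γ a critical point of e}` (torus distance);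
the critical points are exactly the points with all coordinates in `{0, 1/2}` mod `1`,
and minimizing over them coordinatewise gives the formula below. -/
def tnorm (η : ℝ) (q : Fin 3 → ℝ) : ℝ :=
  η + Real.sqrt (∑ j, (min (cdist (q j) 0) (cdist (q j) (1/2))) ^ 2)

/-- `|∇e(q)|`, the Euclidean length of the gradient of the dispersion relation. -/
def gradNorm (q : Fin 3 → ℝ) : ℝ := Real.sqrt (∑ j, (2 * Real.pi * Real.sin (2 * Real.pi * q j)) ^ 2)



lemma phi_core (t : ℝ) (ht : 1 < t) :
    ‖∫ x in (0:ℝ)..(1/2), Complex.exp (Complex.I * t * Real.cos (2 * Real.pi * x))‖ ≤ 2 / Real.sqrt t := by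
  have hpi := Real.pi_gt_three
  set st := Real.sqrt t with hst
  have hst1 : 1 < st := by
    rw [hst]; exact Real.lt_sqrt_of_sq_lt (by simpa using ht)
  have hstsq : st * st = t := Real.mul_self_sqrt (by linarith)
  set τ := 1 / (4 * st) with hτ
  have hτ0 : 0 < τ := by positivity
  have hτ1 : τ < 1/4 := by
    rw [hτ, div_lt_div_iff₀ (by positivity) (by norm_num)]; linarith
  set f : ℝ → ℂ := fun x => Complex.exp (Complex.I * t * Real.cos (2 * Real.pi * x)) with hf
  have hfc : Continuous f := by fun_prop
  have hfn : ∀ x, ‖f x‖ = 1 := by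
    intro x
    have : Complex.I * t * Real.cos (2 * Real.pi * x) = ((t * Real.cos (2 * Real.pi * x) : ℝ) : ℂ) * Complex.I := by
      push_cast; ring
    simp only [hf]; rw [this]; exact Complex.norm_exp_ofReal_mul_I _
  have hfi : ∀ u v : ℝ, IntervalIntegrable f volume u v := fun u v => hfc.intervalIntegrable u v
  have hsplit : (∫ x in (0:ℝ)..(1/2), f x) = (∫ x in (0:ℝ)..τ, f x) + (∫ x in τ..(1/2 - τ), f x)
      + ∫ x in (1/2 - τ)..(1/2), f x := by
    rw [intervalIntegral.integral_add_adjacent_intervals (hfi _ _) (hfi _ _),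
      intervalIntegral.integral_add_adjacent_intervals (hfi _ _) (hfi _ _)]
  have h1 : ‖∫ x in (0:ℝ)..τ, f x‖ ≤ τ := by
    have := intervalIntegral.norm_integral_le_of_norm_le_const (a := 0) (b := τ) (f := f) (C := 1)
      (fun x _ => (hfn x).le)
    simpa [abs_of_pos hτ0] using this
  have h3 : ‖∫ x in (1/2 - τ)..(1/2), f x‖ ≤ τ := by
    have := intervalIntegral.norm_integral_le_of_norm_le_const (a := 1/2 - τ) (b := 1/2) (f := f) (C := 1)
      (fun x _ => (hfn x).le)
    rw [show (1/2 - (1/2 - τ)) = τ by ring, abs_of_pos hτ0] at this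
    linarith
  -- sine facts
  have hsinpos : ∀ x ∈ Set.Icc τ (1/2 - τ), 0 < Real.sin (2 * Real.pi * x) := by
    intro x hx
    apply Real.sin_pos_of_pos_of_lt_pi
    · have : 0 < x := lt_of_lt_of_le hτ0 hx.1
      positivity
    · have : x < 1/2 := by linarith [hx.2]
      nlinarith
  have hle : τ ≤ 1/2 - τ := by linarith
  have hτs : 4 * τ ≤ Real.sin (2 * Real.pi * τ) := by
    have := Real.mul_le_sin (x := 2 * Real.pi * τ) (by positivity) (by nlinarith)
    calc 4 * τ = 2 / Real.pi * (2 * Real.pi * τ) := by field_simp; ring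
      _ ≤ _ := this
  have hend : Real.sin (2 * Real.pi * (1/2 - τ)) = Real.sin (2 * Real.pi * τ) := by
    rw [show 2 * Real.pi * (1/2 - τ) = Real.pi - 2 * Real.pi * τ by ring, Real.sin_pi_sub]
  have hendc : Real.cos (2 * Real.pi * (1/2 - τ)) = - Real.cos (2 * Real.pi * τ) := by
    rw [show 2 * Real.pi * (1/2 - τ) = Real.pi - 2 * Real.pi * τ by ring, Real.cos_pi_sub]
  set S := Real.sin (2 * Real.pi * τ) with hS
  have hS0 : 0 < S := by linarith
  have hdl : ∀ x : ℝ, HasDerivAt (fun x : ℝ => 2 * Real.pi * x) (2 * Real.pi) x := fun x => by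
    simpa using (hasDerivAt_id x).const_mul (2 * Real.pi)
  have hdsin : ∀ x : ℝ, HasDerivAt (fun x : ℝ => Real.sin (2 * Real.pi * x)) (Real.cos (2 * Real.pi * x) * (2 * Real.pi)) x :=
    fun x => (hdl x).sin
  have hdcos : ∀ x : ℝ, HasDerivAt (fun x : ℝ => Real.cos (2 * Real.pi * x)) (-Real.sin (2 * Real.pi * x) * (2 * Real.pi)) x :=
    fun x => (hdl x).cos
  have hdf : ∀ x : ℝ, HasDerivAt f (f x * (Complex.I * t * ((-Real.sin (2 * Real.pi * x) * (2 * Real.pi) : ℝ) : ℂ))) x := by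
    intro x
    have := ((hdcos x).ofReal_comp.const_mul (Complex.I * t)).cexp
    simpa [hf] using this
  set g : ℝ → ℝ := fun x => (2 * Real.pi * t * Real.sin (2 * Real.pi * x))⁻¹ with hg
  set g' : ℝ → ℝ := fun x => - Real.cos (2 * Real.pi * x) / (t * Real.sin (2 * Real.pi * x) ^ 2) with hg'
  have hdg : ∀ x ∈ Set.Icc τ (1/2 - τ), HasDerivAt g (g' x) x := by
    intro x hx
    have hs := hsinpos x hx
    have := ((hdsin x).const_mul (2 * Real.pi * t)).inv (by positivity)
    refine HasDerivAt.congr_deriv this ?_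
    simp only [hg']
    field_simp
  have hF : ∀ x ∈ Set.uIcc τ (1/2 - τ), HasDerivAt (fun x => f x * ((g x : ℂ) * Complex.I))
      (f x + f x * ((g' x : ℂ) * Complex.I)) x := by
    intro x hx
    rw [Set.uIcc_of_le hle] at hx
    have hs := hsinpos x hx
    have := (hdf x).mul ((hdg x hx).ofReal_comp.mul_const Complex.I)
    refine HasDerivAt.congr_deriv this ?_
    simp only [hg]
    have hsC : (Real.sin (2 * Real.pi * x) : ℂ) ≠ 0 := by exact_mod_cast hs.ne'
    have htC : (t : ℂ) ≠ 0 := by exact_mod_cast (by linarith : t ≠ 0)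
    have hpC : (Real.pi : ℂ) ≠ 0 := by exact_mod_cast Real.pi_ne_zero
    have : (1:ℂ) = (Complex.I * t * ((-Real.sin (2 * Real.pi * x) * (2 * Real.pi) : ℝ) : ℂ)) * (((2 * Real.pi * t * Real.sin (2 * Real.pi * x))⁻¹ : ℝ) * Complex.I) := by
      rw [show ∀ u v : ℂ, (Complex.I * t * u) * (v * Complex.I) = - (t * u * v) by
        intro u v; linear_combination (t * u * v) * Complex.I_mul_I]
      rw [Complex.ofReal_inv, Complex.ofReal_mul, Complex.ofReal_mul, Complex.ofReal_mul,
        Complex.ofReal_mul, Complex.ofReal_mul, Complex.ofReal_neg]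
      field_simp
    linear_combination -(f x) * this
  have hg'c : ContinuousOn g' (Set.Icc τ (1/2 - τ)) := by
    simp only [hg']
    apply ContinuousOn.div (by fun_prop) (by fun_prop)
    intro x hx
    have := hsinpos x hx
    positivity
  have hg'i : IntervalIntegrable (fun x => f x * ((g' x : ℂ) * Complex.I)) volume τ (1/2 - τ) := by
    apply ContinuousOn.intervalIntegrable
    rw [Set.uIcc_of_le hle]
    apply hfc.continuousOn.mul
    apply ContinuousOn.mul _ continuousOn_const
    exact Complex.continuous_ofReal.comp_continuousOn hg'c
  have hFTC := intervalIntegral.integral_eq_sub_of_hasDerivAt hF ((hfi _ _).add hg'i)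
  rw [intervalIntegral.integral_add (hfi _ _) hg'i] at hFTC
  -- the cotangent bound
  set c : ℝ → ℝ := fun x => - Real.cos (2 * Real.pi * x) / Real.sin (2 * Real.pi * x) / (2 * Real.pi * t) with hc
  have hdc : ∀ x ∈ Set.uIcc τ (1/2 - τ), HasDerivAt c (1 / (t * Real.sin (2 * Real.pi * x) ^ 2)) x := by
    intro x hx
    rw [Set.uIcc_of_le hle] at hx
    have hs := hsinpos x hx
    have := (((hdcos x).neg.div (hdsin x) hs.ne')).div_const (2 * Real.pi * t)
    refine HasDerivAt.congr_deriv this ?_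
    have h := Real.sin_sq_add_cos_sq (2 * Real.pi * x)
    simp only [Pi.neg_apply]
    field_simp
    linear_combination h
  have hci : IntervalIntegrable (fun x => 1 / (t * Real.sin (2 * Real.pi * x) ^ 2)) volume τ (1/2 - τ) := by
    apply ContinuousOn.intervalIntegrable
    rw [Set.uIcc_of_le hle]
    apply ContinuousOn.div (by fun_prop) (by fun_prop)
    intro x hx
    have := hsinpos x hx
    positivity
  have hcF := intervalIntegral.integral_eq_sub_of_hasDerivAt hdc hci
  have h2b : ‖∫ x in τ..(1/2 - τ), f x * ((g' x : ℂ) * Complex.I)‖ ≤ ∫ x in τ..(1/2 - τ), 1 / (t * Real.sin (2 * Real.pi * x) ^ 2) := by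
    apply intervalIntegral.norm_integral_le_of_norm_le hle _ hci
    refine ae_of_all _ fun x hx => ?_
    have hs := hsinpos x ⟨hx.1.le, hx.2⟩
    rw [norm_mul, hfn, norm_mul, Complex.norm_I, Complex.norm_real, one_mul, mul_one, Real.norm_eq_abs, abs_div, abs_neg,
      abs_of_pos (by positivity : 0 < t * Real.sin (2 * Real.pi * x) ^ 2)]
    gcongr
    exact Real.abs_cos_le_one _
  have hcv : c (1/2 - τ) - c τ ≤ 1 / (Real.pi * t * S) := by
    simp only [hc]
    rw [hend, hendc, ← hS]
    have : - -Real.cos (2 * Real.pi * τ) / S / (2 * Real.pi * t) - -Real.cos (2 * Real.pi * τ) / S / (2 * Real.pi * t)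
      = Real.cos (2 * Real.pi * τ) / (Real.pi * t * S) := by
      field_simp; ring
    rw [this]
    gcongr
    exact Real.cos_le_one _
  have hgn : ∀ x, Real.sin (2 * Real.pi * x) = S → ‖f x * ((g x : ℂ) * Complex.I)‖ = 1 / (2 * Real.pi * t * S) := by
    intro x hx
    rw [norm_mul, hfn, norm_mul, Complex.norm_I, Complex.norm_real, one_mul, mul_one]
    simp only [hg]
    rw [hx, Real.norm_eq_abs, abs_of_pos (by positivity), one_div]
  have h2 : ‖∫ x in τ..(1/2 - τ), f x‖ ≤ 2 / (Real.pi * t * S) := by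
    have e : (∫ x in τ..(1/2 - τ), f x) = f (1/2 - τ) * ((g (1/2 - τ) : ℂ) * Complex.I) - f τ * ((g τ : ℂ) * Complex.I)
      - ∫ x in τ..(1/2 - τ), f x * ((g' x : ℂ) * Complex.I) := by
      rw [← hFTC]; ring
    rw [e]
    refine (norm_sub_le _ _).trans ((add_le_add (norm_sub_le _ _) h2b).trans ?_)
    rw [hgn _ hend, hgn _ hS.symm, hcF]
    calc _ ≤ 1 / (2 * Real.pi * t * S) + 1 / (2 * Real.pi * t * S) + 1 / (Real.pi * t * S) := by gcongr
      _ = _ := by field_simp; ring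
  have h2' : 2 / (Real.pi * t * S) ≤ 1 / st := by
    have : 4 * τ = 1 / st := by rw [hτ]; field_simp
    rw [this] at hτs
    have h5 : Real.pi * t * (1 / st) ≤ Real.pi * t * S := by gcongr
    have h6 : Real.pi * t * (1 / st) = Real.pi * st := by rw [← hstsq]; field_simp
    rw [div_le_div_iff₀ (by positivity) (by positivity)]
    nlinarith
  have hτ2 : 2 * τ ≤ 1 / st := by
    rw [hτ]; rw [mul_one_div, div_le_div_iff₀ (by positivity) (by positivity)]; linarith
  rw [hsplit]
  calc _ ≤ τ + 2 / (Real.pi * t * S) + τ := norm_add₃_le.trans (by gcongr)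
    _ ≤ 1 / st + 1 / st := by linarith
    _ = _ := by ring

/-- one-dimensional oscillatory integral -/
def phi1 (t : ℝ) : ℂ := ∫ x in Set.Icc (-(1/2) : ℝ) (1/2), Complex.exp (-(Complex.I * t * ((1 - Real.cos (2 * Real.pi * x) : ℝ) : ℂ)))

lemma phi1_le_one (t : ℝ) : ‖phi1 t‖ ≤ 1 := by
  have := norm_setIntegral_le_of_norm_le_const (μ := volume) (s := Set.Icc (-(1/2) : ℝ) (1/2)) (C := 1)
    (f := fun x : ℝ => Complex.exp (-(Complex.I * t * ((1 - Real.cos (2 * Real.pi * x) : ℝ) : ℂ)))) (by simp) (by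
      intro x _
      rw [show -(Complex.I * t * ((1 - Real.cos (2 * Real.pi * x) : ℝ) : ℂ)) = ((-(t * (1 - Real.cos (2 * Real.pi * x))) : ℝ) : ℂ) * Complex.I by
        push_cast; ring]
      rw [Complex.norm_exp_ofReal_mul_I])
  refine this.trans ?_
  simp [Measure.real]
  norm_num

lemma phi1_le (t : ℝ) (ht : 1 < t) : ‖phi1 t‖ ≤ 4 / Real.sqrt t := by
  have hc : Continuous fun x : ℝ => Complex.exp (Complex.I * t * Real.cos (2 * Real.pi * x)) := by fun_prop
  have e : phi1 t = Complex.exp (-(Complex.I * t)) * (2 * ∫ x in (0:ℝ)..(1/2), Complex.exp (Complex.I * t * Real.cos (2 * Real.pi * x))) := by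
    unfold phi1
    rw [integral_Icc_eq_integral_Ioc, ← intervalIntegral.integral_of_le (by norm_num)]
    have h : ∀ x : ℝ, Complex.exp (-(Complex.I * t * ((1 - Real.cos (2 * Real.pi * x) : ℝ) : ℂ)))
      = Complex.exp (-(Complex.I * t)) * Complex.exp (Complex.I * t * Real.cos (2 * Real.pi * x)) := by
      intro x
      rw [← Complex.exp_add]; congr 1; push_cast; ring
    simp_rw [h]
    rw [intervalIntegral.integral_const_mul]
    congr 1
    rw [← intervalIntegral.integral_add_adjacent_intervals (hc.intervalIntegrable (-(1/2)) 0) (hc.intervalIntegrable 0 (1/2)), two_mul (intervalIntegral _ _ _ _)]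
    congr 1
    have := intervalIntegral.integral_comp_neg (a := -(1/2)) (b := 0) (fun x : ℝ => Complex.exp (Complex.I * t * Real.cos (2 * Real.pi * x)))
    simp only [mul_neg, Real.cos_neg, neg_zero, neg_neg] at this
    exact this
  rw [e, norm_mul, norm_mul, Complex.norm_exp]
  have := phi_core t ht
  simp only [Complex.neg_re, Complex.mul_re, Complex.I_re, Complex.ofReal_re, Complex.I_im, Complex.ofReal_im]
  norm_num at this ⊢
  calc _ ≤ 2 * (2 / Real.sqrt t) := by gcongr
    _ = _ := by ring

def Psi3 (t : ℝ) : ℂ := ∫ q in T3, Complex.exp (-(Complex.I * t * (edisp q : ℂ)))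

lemma Psi3_eq (t : ℝ) : Psi3 t = phi1 t ^ 3 := by
  unfold Psi3 phi1 T3
  rw [volume_pi, Measure.restrict_pi_pi]
  have h : ∀ q : Fin 3 → ℝ, Complex.exp (-(Complex.I * t * (edisp q : ℂ)))
    = ∏ j, Complex.exp (-(Complex.I * t * ((1 - Real.cos (2 * Real.pi * q j) : ℝ) : ℂ))) := by
    intro q
    rw [← Complex.exp_sum]; congr 1
    simp only [edisp, Finset.sum_neg_distrib, ← Finset.mul_sum, Complex.ofReal_sum]
  simp_rw [h]
  rw [integral_fintype_prod_eq_prod (f := fun _ (x : ℝ) => Complex.exp (-(Complex.I * t * ((1 - Real.cos (2 * Real.pi * x) : ℝ) : ℂ))))]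
  simp

lemma continuous_edisp : Continuous edisp := by unfold edisp; fun_prop

lemma T3_compact : IsCompact T3 := isCompact_univ_pi fun _ => isCompact_Icc

lemma T3_volume : volume T3 = 1 := by
  unfold T3
  rw [volume_pi_pi]
  norm_num

instance T3_prob : IsProbabilityMeasure (volume.restrict T3) := ⟨by simp [T3_volume]⟩

lemma Psi3_le_one (t : ℝ) : ‖Psi3 t‖ ≤ 1 := by
  rw [Psi3_eq, norm_pow]
  exact pow_le_one₀ (norm_nonneg _) (phi1_le_one t)

lemma Psi3_le (t : ℝ) (ht : 1 < t) : ‖Psi3 t‖ ≤ 64 * t ^ (-(3/2) : ℝ) := by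
  rw [Psi3_eq, norm_pow]
  have h := phi1_le t ht
  have e : (4 / Real.sqrt t) ^ 3 = 64 * t ^ (-(3/2) : ℝ) := by
    rw [Real.sqrt_eq_rpow, div_pow, ← Real.rpow_natCast (t ^ (1/2 : ℝ)), ← Real.rpow_mul (by linarith), Real.rpow_neg (by linarith)]
    norm_num
    rw [div_eq_mul_inv]
  rw [← e]
  gcongr

lemma Psi3_meas : StronglyMeasurable Psi3 := by
  have hc : Continuous (fun z : ℝ × (Fin 3 → ℝ) => Complex.exp (-(Complex.I * z.1 * (edisp z.2 : ℂ)))) := by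
    have := continuous_edisp
    fun_prop
  exact hc.stronglyMeasurable.integral_prod_right' (ν := volume.restrict T3)

def wdom (t : ℝ) : ℝ := if t ≤ 1 then 1 else 64 * t ^ (-(5/4) : ℝ)

lemma wdom_int : IntegrableOn wdom (Set.Ioi 0) := by
  rw [← Set.Ioc_union_Ioi_eq_Ioi (zero_le_one' ℝ)]
  apply IntegrableOn.union
  · have : IntegrableOn (fun _ : ℝ => (1:ℝ)) (Set.Ioc 0 1) := by simp
    refine this.congr_fun ?_ measurableSet_Ioc
    intro x hx
    simp [wdom, hx.2]
  · have : IntegrableOn (fun t : ℝ => 64 * t ^ (-(5/4) : ℝ)) (Set.Ioi 1) :=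
      (integrableOn_Ioi_rpow_of_lt (by norm_num) one_pos).const_mul 64
    refine this.congr_fun ?_ measurableSet_Ioi
    intro x hx
    simp only [wdom]
    rw [if_neg (not_le.mpr hx)]

lemma Psi3_wdom (t : ℝ) (ht : 0 < t) : ‖Psi3 t‖ ≤ wdom t := by
  unfold wdom
  split_ifs with h
  · exact Psi3_le_one t
  · push Not at h
    refine (Psi3_le t h).trans ?_
    exact mul_le_mul_of_nonneg_left (Real.rpow_le_rpow_of_exponent_le h.le (by norm_num)) (by norm_num)

lemma Psi3_wdom' (t : ℝ) (ht : 0 < t) : t ^ (1/4 : ℝ) * ‖Psi3 t‖ ≤ wdom t := by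
  unfold wdom
  split_ifs with h
  · exact mul_le_one₀ (Real.rpow_le_one ht.le h (by norm_num)) (norm_nonneg _) (Psi3_le_one t)
  · push Not at h
    calc t ^ (1/4 : ℝ) * ‖Psi3 t‖ ≤ t ^ (1/4 : ℝ) * (64 * t ^ (-(3/2) : ℝ)) := by
          gcongr; exact Psi3_le t h
      _ = 64 * (t ^ (1/4 : ℝ) * t ^ (-(3/2) : ℝ)) := by ring
      _ = _ := by rw [← Real.rpow_add ht]; norm_num

lemma exp_line (ε α t : ℝ) : ‖Complex.exp ((Complex.I * α - ε) * t)‖ = Real.exp (-(ε * t)) := by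
  rw [Complex.norm_exp]; simp

lemma ThetaEps_eq (ε α : ℝ) (hε : 0 < ε) :
    ThetaEps ε α = ∫ t in Set.Ioi (0:ℝ), -Complex.I * Complex.exp ((Complex.I * α - ε) * t) * Psi3 t := by
  have hce := continuous_edisp
  have h1 : ∀ q, ((α : ℂ) - (edisp q : ℂ) + (ε : ℂ) * Complex.I)⁻¹ =
      ∫ t in Set.Ioi (0:ℝ), -Complex.I * Complex.exp ((Complex.I * α - ε) * t) * Complex.exp (-(Complex.I * t * (edisp q : ℂ))) := by
    intro q
    have e : ∀ t : ℝ, -Complex.I * Complex.exp ((Complex.I * α - ε) * t) * Complex.exp (-(Complex.I * t * (edisp q : ℂ)))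
        = -Complex.I * Complex.exp ((Complex.I * ((α : ℂ) - (edisp q : ℂ) + (ε : ℂ) * Complex.I)) * t) := by
      intro t
      rw [mul_assoc, ← Complex.exp_add]
      congr 2
      linear_combination -(t:ℂ) * ε * Complex.I_mul_I
    simp_rw [e]
    rw [integral_const_mul, integral_exp_mul_complex_Ioi (by simp [hε])]
    have hz : ((α : ℂ) - (edisp q : ℂ) + (ε : ℂ) * Complex.I) ≠ 0 := by
      intro h
      have := congrArg Complex.im h
      simp at this
      exact hε.ne' this
    simp
    field_simp
  unfold ThetaEps
  simp_rw [h1]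
  rw [integral_integral_swap]
  · unfold Psi3
    refine integral_congr_ae (ae_of_all _ fun t => ?_)
    simp only
    rw [integral_const_mul]
  · have hb : IntegrableOn (fun t : ℝ => Real.exp (-ε * t)) (Set.Ioi 0) := exp_neg_integrableOn_Ioi 0 hε
    have hb2 := hb.comp_snd (volume.restrict T3)
    refine hb2.mono' ?_ ?_
    · apply Continuous.aestronglyMeasurable
      unfold Function.uncurry
      fun_prop
    · refine ae_of_all _ fun z => ?_
      simp only [Function.uncurry]
      rw [norm_mul, norm_mul, exp_line]
      rw [show -(Complex.I * z.2 * (edisp z.1 : ℂ)) = ((-(z.2 * edisp z.1) : ℝ) : ℂ) * Complex.I by push_cast; ring,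
        Complex.norm_exp_ofReal_mul_I]
      simp

lemma exp_holder (z w : ℂ) (hz : z.re ≤ 0) (hw : w.re ≤ 0) :
    ‖Complex.exp z - Complex.exp w‖ ≤ 2 * ‖z - w‖ ^ (1/4 : ℝ) := by
  have n1 : ∀ u : ℂ, u.re ≤ 0 → ‖Complex.exp u‖ ≤ 1 := fun u hu => by
    rw [Complex.norm_exp]; simpa using hu
  by_cases h : ‖z - w‖ ≤ 1
  · have hl : ‖Complex.exp z - Complex.exp w‖ ≤ 1 * ‖z - w‖ := by
      have hconv : Convex ℝ {u : ℂ | u.re ≤ 0} := convex_halfSpace_re_le 0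
      exact hconv.norm_image_sub_le_of_norm_deriv_le (f := Complex.exp)
        (fun u _ => Complex.differentiableAt_exp)
        (fun u hu => by rw [Complex.deriv_exp]; exact n1 u hu) hw hz
    have : ‖z - w‖ ≤ ‖z - w‖ ^ (1/4 : ℝ) := by
      rcases (norm_nonneg (z - w)).eq_or_lt with h0 | h0
      · rw [← h0]; positivity
      · exact Real.self_le_rpow_of_le_one h0.le h (by norm_num)
    have h0 : 0 ≤ ‖z - w‖ ^ (1/4 : ℝ) := by positivity
    linarith
  · push Not at h
    have : 1 ≤ ‖z - w‖ ^ (1/4 : ℝ) := Real.one_le_rpow h.le (by norm_num)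
    have := norm_sub_le (Complex.exp z) (Complex.exp w)
    linarith [n1 z hz, n1 w hw]

lemma Theta_est : ∃ K : ℝ, 1 ≤ K ∧ (∀ ε α : ℝ, 0 < ε → ‖ThetaEps ε α‖ ≤ K) ∧
    ∀ ε ε' α α' : ℝ, 0 < ε → 0 < ε' →
      ‖ThetaEps ε α - ThetaEps ε' α'‖ ≤ K * (|α - α'| + |ε - ε'|) ^ (1/4 : ℝ) := by
  have hw0 : 0 ≤ ∫ t in Set.Ioi (0:ℝ), wdom t := by
    apply setIntegral_nonneg measurableSet_Ioi
    intro t ht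
    exact (norm_nonneg _).trans (Psi3_wdom t ht)
  have hb : ∀ ε α t : ℝ, 0 < ε → 0 < t → ‖-Complex.I * Complex.exp ((Complex.I * α - ε) * t) * Psi3 t‖ ≤ wdom t := by
    intro ε α t hε ht
    rw [norm_mul, norm_mul, exp_line]
    have : Real.exp (-(ε * t)) ≤ 1 := by rw [Real.exp_le_one_iff]; nlinarith
    have h2 := Psi3_wdom t ht
    simp only [norm_neg, Complex.norm_I, one_mul]
    calc _ ≤ 1 * ‖Psi3 t‖ := by gcongr
      _ ≤ _ := by rw [one_mul]; exact h2
  have hint : ∀ ε α : ℝ, 0 < ε → IntegrableOn (fun t : ℝ => -Complex.I * Complex.exp ((Complex.I * α - ε) * t) * Psi3 t) (Set.Ioi 0) := by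
    intro ε α hε
    refine Integrable.mono' wdom_int ?_ ?_
    · apply AEStronglyMeasurable.mul
      · apply Continuous.aestronglyMeasurable; fun_prop
      · exact Psi3_meas.aestronglyMeasurable
    · exact (ae_restrict_mem measurableSet_Ioi).mono fun t ht => hb ε α t hε ht
  refine ⟨1 + 2 * ∫ t in Set.Ioi (0:ℝ), wdom t, by linarith, ?_, ?_⟩
  · intro ε α hε
    rw [ThetaEps_eq ε α hε]
    refine (norm_integral_le_of_norm_le wdom_int
      ((ae_restrict_mem measurableSet_Ioi).mono fun t ht => hb ε α t hε ht)).trans ?_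
    linarith
  · intro ε ε' α α' hε hε'
    rw [ThetaEps_eq ε α hε, ThetaEps_eq ε' α' hε', ← integral_sub (hint ε α hε) (hint ε' α' hε')]
    set d := |α - α'| + |ε - ε'| with hd
    have hd0 : 0 ≤ d := by positivity
    refine (norm_integral_le_of_norm_le (wdom_int.const_mul (2 * d ^ (1/4 : ℝ)))
      ((ae_restrict_mem measurableSet_Ioi).mono fun t ht => ?_)).trans ?_
    · have ht' : 0 < t := ht
      rw [← sub_mul, ← mul_sub, norm_mul, norm_mul, norm_neg, Complex.norm_I, one_mul]
      have h1 := exp_holder ((Complex.I * α - ε) * t) ((Complex.I * α' - ε') * t)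
        (by simp; nlinarith) (by simp; nlinarith)
      have h2 : ‖(Complex.I * α - ε) * t - (Complex.I * α' - ε') * t‖ ≤ d * t := by
        rw [← sub_mul, norm_mul, Complex.norm_real, Real.norm_eq_abs, abs_of_pos ht']
        gcongr
        rw [show (Complex.I * α - ε) - (Complex.I * α' - ε') = Complex.I * ((α - α' : ℝ) : ℂ) - ((ε - ε' : ℝ) : ℂ) by push_cast; ring]
        refine (norm_sub_le _ _).trans ?_
        rw [norm_mul, Complex.norm_I, Complex.norm_real, Complex.norm_real, one_mul, hd]
        rfl
      calc _ ≤ (2 * (d * t) ^ (1/4 : ℝ)) * ‖Psi3 t‖ := by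
            gcongr
            refine h1.trans ?_
            gcongr
        _ = 2 * d ^ (1/4 : ℝ) * (t ^ (1/4 : ℝ) * ‖Psi3 t‖) := by
            rw [Real.mul_rpow hd0 ht'.le]; ring
        _ ≤ _ := by
            gcongr
            exact Psi3_wdom' t ht'
    · rw [integral_const_mul]
      have : 0 ≤ d ^ (1/4 : ℝ) := by positivity
      nlinarith

lemma poisson (y x : ℝ) (hy : 0 < y) :
    ∫ q in T3, 1 / ((x - edisp q) ^ 2 + y ^ 2) = -(ThetaEps y x).im / y := by
  have hce := continuous_edisp
  have hz : ∀ q, ((x : ℂ) - (edisp q : ℂ) + (y : ℂ) * Complex.I) ≠ 0 := by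
    intro q h
    have := congrArg Complex.im h
    simp at this
    exact hy.ne' this
  have hint : Integrable (fun q => ((x : ℂ) - (edisp q : ℂ) + (y : ℂ) * Complex.I)⁻¹) (volume.restrict T3) := by
    apply ContinuousOn.integrableOn_compact T3_compact
    apply Continuous.continuousOn
    exact Continuous.inv₀ (by fun_prop) hz
  have h1 : (ThetaEps y x).im = ∫ q in T3, (((x : ℂ) - (edisp q : ℂ) + (y : ℂ) * Complex.I)⁻¹).im := by
    unfold ThetaEps
    exact (Complex.imCLM.integral_comp_comm hint).symm
  have h2 : ∀ q, (((x : ℂ) - (edisp q : ℂ) + (y : ℂ) * Complex.I)⁻¹).im = (-y) * (1 / ((x - edisp q) ^ 2 + y ^ 2)) := by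
    intro q
    rw [Complex.inv_im]
    simp [Complex.normSq_apply]
    rw [← sq, ← sq, div_eq_mul_inv]
    ring
  rw [h1]
  simp_rw [h2]
  rw [integral_const_mul]
  field_simp

lemma poisson_int (y x : ℝ) (hy : 0 < y) :
    Integrable (fun q => 1 / ((x - edisp q) ^ 2 + y ^ 2)) (volume.restrict T3) := by
  have hce := continuous_edisp
  apply ContinuousOn.integrableOn_compact T3_compact
  apply Continuous.continuousOn
  exact Continuous.div (by fun_prop) (by fun_prop) (fun q => by positivity)

lemma quarter (c x y : ℝ) (hc : 0 ≤ c) (hx : 0 ≤ x) (hy : 0 ≤ y) (h : 16 * c ^ 4 * x ≤ y ^ 4) :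
    c * x ^ (1/4 : ℝ) ≤ y / 2 := by
  set u := x ^ (1/4 : ℝ) with hu
  have hu0 : 0 ≤ u := by positivity
  have hu4 : u ^ 4 = x := by
    rw [hu, ← Real.rpow_natCast, ← Real.rpow_mul hx]; norm_num
  rw [← hu4] at h
  have : (2 * c * u) ^ 4 ≤ y ^ 4 := by
    calc _ = 16 * c ^ 4 * u ^ 4 := by ring
      _ ≤ _ := h
  have := (pow_le_pow_iff_left₀ (by positivity) hy (by norm_num : (4:ℕ) ≠ 0)).1 this
  linarith

lemma dyad (a m s : ℝ) (N : ℕ) (ha0 : 0 ≤ a) (ha : a < 1) (hm : 0 < m) (hs : 0 ≤ s) (hN : 1 ≤ N)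
    (hsN : s < 2 ^ N * m) :
    1 / (max s m) ^ (2 - a) ≤ ∑ k ∈ Finset.range N, 4 * (2 ^ k * m) ^ a * (1 / (s ^ 2 + (2 ^ k * m) ^ 2)) := by
  set x := max s m with hx
  have hmx : m ≤ x := le_max_right _ _
  have hsx : s ≤ x := le_max_left _ _
  have hx0 : 0 < x := lt_of_lt_of_le hm hmx
  obtain ⟨k, hk1, hk2⟩ := exists_nat_pow_near (x := x / m) (y := 2) ((one_le_div hm).2 hmx) (by norm_num)
  rw [le_div_iff₀ hm] at hk1
  rw [div_lt_iff₀ hm] at hk2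
  have hxN : x < 2 ^ N * m := by
    rw [hx]; apply max_lt hsN
    have : (1:ℝ) < 2 ^ N := one_lt_pow₀ (by norm_num) (by omega)
    nlinarith
  have hkN : k < N := by
    have : (2:ℝ) ^ k < 2 ^ N := lt_of_mul_lt_mul_right (hk1.trans_lt hxN) hm.le
    exact (pow_lt_pow_iff_right₀ (by norm_num)).1 this
  refine le_trans ?_ (Finset.single_le_sum (f := fun k => 4 * (2 ^ k * m) ^ a * (1 / (s ^ 2 + (2 ^ k * m) ^ 2)))
    (fun i _ => by positivity) (Finset.mem_range.2 hkN))
  set y := 2 ^ k * m with hy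
  have hy0 : 0 < y := by positivity
  have hxy : x ≤ 2 * y := by rw [hy]; rw [pow_succ] at hk2; linarith
  have h1 : x ^ a ≤ 2 * y ^ a := by
    calc x ^ a ≤ (2 * y) ^ a := by gcongr
      _ = 2 ^ a * y ^ a := Real.mul_rpow (by norm_num) hy0.le
      _ ≤ 2 * y ^ a := by
        gcongr
        calc (2:ℝ) ^ a ≤ 2 ^ (1:ℝ) := Real.rpow_le_rpow_of_exponent_le (by norm_num) ha.le
          _ = 2 := by simp
  have h2 : s ^ 2 + y ^ 2 ≤ 2 * x ^ 2 := by
    have : s ^ 2 ≤ x ^ 2 := by gcongr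
    have : y ^ 2 ≤ x ^ 2 := by gcongr
    linarith
  rw [Real.rpow_sub hx0, Real.rpow_two]
  rw [one_div_div, mul_one_div, div_le_div_iff₀ (by positivity) (by positivity)]
  calc x ^ a * (s ^ 2 + y ^ 2) ≤ (2 * y ^ a) * (2 * x ^ 2) := by gcongr
    _ = _ := by ring

/-- the simple part: integral of max(s,m)^{-(2-a)} -/
lemma far_integral (K : ℝ) (hK : 1 ≤ K) (hM : ∀ ε α : ℝ, 0 < ε → ‖ThetaEps ε α‖ ≤ K)
    (a : ℝ) (ha0 : 0 ≤ a) (ha : a < 1) (m x : ℝ) (hm : 0 < m) :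
    ∫ q in T3, 1 / (max |x - edisp q| m) ^ (2 - a) ≤ 4 * K / (1 - 2 ^ (a - 1)) * m ^ (a - 1) := by
  have hce := continuous_edisp
  obtain ⟨B, hB⟩ := T3_compact.exists_bound_of_continuousOn (f := fun q => x - edisp q) (by fun_prop)
  obtain ⟨N, hN⟩ := pow_unbounded_of_one_lt (B / m) (by norm_num : (1:ℝ) < 2)
  have hBN : B < 2 ^ (N + 1) * m := by
    rw [div_lt_iff₀ hm] at hN
    have : 0 < (2:ℝ) ^ N * m := by positivity
    rw [pow_succ]; linarith
  have hint : ∀ k ∈ Finset.range (N+1), Integrable (fun q => 4 * (2 ^ k * m) ^ a * (1 / (|x - edisp q| ^ 2 + (2 ^ k * m) ^ 2))) (volume.restrict T3) := by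
    intro k _
    simp_rw [sq_abs]
    exact (poisson_int (2 ^ k * m) x (by positivity)).const_mul _
  have h2 : (2:ℝ) ^ (a - 1) < 1 := Real.rpow_lt_one_of_one_lt_of_neg (by norm_num) (by linarith)
  calc _ ≤ ∫ q in T3, ∑ k ∈ Finset.range (N+1), 4 * (2 ^ k * m) ^ a * (1 / (|x - edisp q| ^ 2 + (2 ^ k * m) ^ 2)) := by
        apply integral_mono_of_nonneg
        · exact ae_of_all _ fun q => by positivity
        · exact integrable_finset_sum _ hint
        · refine (ae_restrict_mem T3_compact.measurableSet).mono fun q hq => ?_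
          exact dyad a m _ (N+1) ha0 ha hm (abs_nonneg _) (by omega) ((hB q hq).trans_lt hBN)
    _ = ∑ k ∈ Finset.range (N+1), 4 * (2 ^ k * m) ^ a * (-(ThetaEps (2 ^ k * m) x).im / (2 ^ k * m)) := by
        rw [integral_finset_sum _ hint]
        refine Finset.sum_congr rfl fun k _ => ?_
        rw [integral_const_mul]
        simp_rw [sq_abs]
        rw [poisson _ _ (by positivity)]
    _ ≤ ∑ k ∈ Finset.range (N+1), 4 * K * m ^ (a - 1) * (2 ^ (a - 1)) ^ k := by
        refine Finset.sum_le_sum fun k _ => ?_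
        have hy : 0 < 2 ^ k * m := by positivity
        have hi : -(ThetaEps (2 ^ k * m) x).im ≤ K :=
          (neg_le_abs _).trans ((Complex.abs_im_le_norm _).trans (hM _ _ hy))
        have e : (2 ^ k * m) ^ a / (2 ^ k * m) = m ^ (a - 1) * (2 ^ (a - 1)) ^ k := by
          rw [← Real.rpow_sub_one hy.ne', Real.mul_rpow (by positivity) hm.le, ← Real.rpow_natCast, ← Real.rpow_natCast,
            ← Real.rpow_mul (by norm_num), ← Real.rpow_mul (by norm_num), mul_comm (k:ℝ)]
          ring
        calc _ ≤ 4 * (2 ^ k * m) ^ a * (K / (2 ^ k * m)) := by gcongr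
          _ = 4 * K * ((2 ^ k * m) ^ a / (2 ^ k * m)) := by ring
          _ = _ := by rw [e]; ring
    _ = 4 * K * m ^ (a - 1) * ∑ k ∈ Finset.range (N+1), ((2:ℝ) ^ (a - 1)) ^ k := by rw [Finset.mul_sum]
    _ ≤ 4 * K * m ^ (a - 1) * (1 / (1 - 2 ^ (a - 1))) := by
        gcongr
        have := Summable.sum_le_tsum (Finset.range (N+1)) (fun k _ => by positivity) (summable_geometric_of_lt_one (by positivity) h2)
        rwa [tsum_geometric_of_lt_one (by positivity) h2, ← one_div] at this
    _ = _ := by ring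

lemma theta_lim (K : ℝ) (hK : 1 ≤ K) (hM : ∀ ε α : ℝ, 0 < ε → ‖ThetaEps ε α‖ ≤ K)
    (hH : ∀ ε ε' α α' : ℝ, 0 < ε → 0 < ε' →
      ‖ThetaEps ε α - ThetaEps ε' α'‖ ≤ K * (|α - α'| + |ε - ε'|) ^ (1/4 : ℝ))
    (Θ : ℝ → ℂ) (hΘ : IsThetaLimit Θ) :
    (∀ x, ‖Θ x‖ ≤ K) ∧ (∀ x y, ‖Θ x - Θ y‖ ≤ K * |x - y| ^ (1/4 : ℝ)) ∧
    (∀ ε x, 0 < ε → ‖ThetaEps ε x - Θ x‖ ≤ K * ε ^ (1/4 : ℝ)) ∧ (∀ x, 0 ≤ -(Θ x).im) := by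
  have hpos : ∀ᶠ ε : ℝ in 𝓝[>] (0:ℝ), 0 < ε := eventually_mem_nhdsWithin
  refine ⟨fun x => ?_, fun x y => ?_, fun ε x hε => ?_, fun x => ?_⟩
  · exact le_of_tendsto (hΘ x).norm (hpos.mono fun ε hε => hM ε x hε)
  · refine le_of_tendsto ((hΘ x).sub (hΘ y)).norm (hpos.mono fun ε hε => ?_)
    simpa using hH ε ε x y hε hε
  · refine le_of_tendsto_of_tendsto (tendsto_const_nhds.sub (hΘ x)).norm
      (g := fun ε' => K * |ε - ε'| ^ (1/4 : ℝ)) ?_ (hpos.mono fun ε' hε' => ?_)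
    · have : Continuous fun ε' : ℝ => K * |ε - ε'| ^ (1/4 : ℝ) := by
        apply continuous_const.mul
        exact (continuous_const.sub continuous_id).abs.rpow_const (fun _ => Or.inr (by norm_num))
      have := (this.tendsto 0).mono_left (nhdsWithin_le_nhds (s := Set.Ioi 0))
      simpa [abs_of_pos hε] using this
    · simpa using hH ε ε' x x hε hε'
  · have h := ((Complex.continuous_im.tendsto _).comp (hΘ x)).neg
    refine ge_of_tendsto h (hpos.mono fun ε hε => ?_)
    have := poisson ε x hε
    have h2 : 0 ≤ -(ThetaEps ε x).im / ε := by
      rw [← this]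
      exact integral_nonneg fun q => by positivity
    have h3 := mul_nonneg h2 hε.le
    rwa [div_mul_cancel₀ _ hε.ne'] at h3

lemma surj (K : ℝ) (lam : ℝ) (Θ : ℝ → ℂ) (h1 : ∀ x, ‖Θ x‖ ≤ K)
    (h2 : ∀ x y, ‖Θ x - Θ y‖ ≤ K * |x - y| ^ (1/4 : ℝ)) (α : ℝ) :
    ∃ x, x + lam ^ 2 * (Θ x).re = α := by
  have hc : Continuous Θ := by
    rw [continuous_iff_continuousAt]
    intro x
    rw [ContinuousAt, tendsto_iff_norm_sub_tendsto_zero]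
    refine squeeze_zero (fun _ => norm_nonneg _) (fun y => h2 y x) ?_
    have : Continuous fun y : ℝ => K * |y - x| ^ (1/4 : ℝ) := by
      apply continuous_const.mul
      exact (continuous_id.sub continuous_const).abs.rpow_const (fun _ => Or.inr (by norm_num))
    have := this.tendsto x
    simpa using this
  have hb : ∀ x, |(Θ x).re| ≤ K := fun x => (Complex.abs_re_le_norm _).trans (h1 x)
  have hcf : Continuous fun x : ℝ => x + lam ^ 2 * (Θ x).re := by fun_prop
  refine hcf.surjective ?_ ?_ α
  · refine tendsto_atTop_mono (f := fun x => x + -(lam ^ 2 * K)) (fun x => ?_) (tendsto_atTop_add_const_right _ _ tendsto_id)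
    have := (abs_le.1 (hb x)).1
    have := sq_nonneg lam
    nlinarith
  · refine tendsto_atBot_mono (g := fun x : ℝ => x + lam ^ 2 * (Θ x).re) (f := fun x => x + (lam ^ 2 * K)) (fun x => ?_) (tendsto_atBot_add_const_right _ _ tendsto_id)
    have := (abs_le.1 (hb x)).2
    have := sq_nonneg lam
    nlinarith

/-- the sharp quadratic estimate -/
lemma core (K : ℝ) (hK : 1 ≤ K) (Θ : ℝ → ℂ)
    (h2 : ∀ x y, ‖Θ x - Θ y‖ ≤ K * |x - y| ^ (1/4 : ℝ))
    (h3 : ∀ ε x, 0 < ε → ‖ThetaEps ε x - Θ x‖ ≤ K * ε ^ (1/4 : ℝ)) (h4 : ∀ x, 0 ≤ -(Θ x).im)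
    (lam η x0 : ℝ) (hl0 : 0 < lam) (hl : 16 * K ^ 4 * lam ≤ 1) (hη0 : 0 < η) (hη : lam ^ 7 ≤ η ^ 3)
    (X : ℝ → ℝ) (hX1 : ∀ e, |(x0 + lam ^ 2 * (Θ x0).re) - (e + lam ^ 2 * (Θ e).re)| ≤ X e)
    (hX2 : ∀ e, lam ^ 2 * (-(Θ e).im) + η ≤ X e) :
    ∃ m, 0 < m ∧ (∀ e, (x0 - e) ^ 2 + m ^ 2 ≤ 8 * X e ^ 2) ∧
      8 * ∫ q in T3, 1 / ((x0 - edisp q) ^ 2 + m ^ 2) ≤ (8 * (16 * K ^ 4 + K)) / lam ^ 2 := by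
  have hK4 : 1 ≤ K ^ 4 := one_le_pow₀ hK
  have hlam1 : lam ≤ 1 := by nlinarith
  set r := -(Θ x0).im with hr
  have hr0 : 0 ≤ r := h4 x0
  have hX0 : ∀ e, 0 ≤ X e := fun e => (abs_nonneg _).trans (hX1 e)
  -- far region
  have hfar : ∀ e, 16 * K ^ 4 * lam ^ 8 ≤ |x0 - e| ^ 3 → |x0 - e| / 2 ≤ X e := by
    intro e he
    set s := |x0 - e| with hs
    have hs0 : 0 ≤ s := abs_nonneg _
    have hq := quarter (K * lam ^ 2) s s (by positivity) hs0 hs0 (by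
      calc _ = (16 * K ^ 4 * lam ^ 8) * s := by ring
        _ ≤ s ^ 3 * s := by gcongr
        _ = _ := by ring)
    have hd : |(Θ x0).re - (Θ e).re| ≤ K * s ^ (1/4 : ℝ) := by
      rw [← Complex.sub_re]
      exact (Complex.abs_re_le_norm _).trans (h2 x0 e)
    have : s ≤ |(x0 + lam ^ 2 * (Θ x0).re) - (e + lam ^ 2 * (Θ e).re)| + lam ^ 2 * |(Θ x0).re - (Θ e).re| := by
      rw [hs, ← abs_of_nonneg (sq_nonneg lam), ← abs_mul, abs_of_nonneg (sq_nonneg lam)]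
      calc |x0 - e| = |((x0 + lam ^ 2 * (Θ x0).re) - (e + lam ^ 2 * (Θ e).re)) - lam ^ 2 * ((Θ x0).re - (Θ e).re)| := by
            congr 1; ring
        _ ≤ _ := abs_sub _ _
    have h5 : lam ^ 2 * |(Θ x0).re - (Θ e).re| ≤ s / 2 := by
      calc _ ≤ lam ^ 2 * (K * s ^ (1/4 : ℝ)) := by gcongr
        _ = K * lam ^ 2 * s ^ (1/4 : ℝ) := by ring
        _ ≤ _ := hq
    linarith [hX1 e]
  -- assemble
  have hasm : ∀ m, 0 < m → 16 * K ^ 4 * lam ^ 8 ≤ m ^ 3 → (∀ e, |x0 - e| ≤ m → m / 2 ≤ X e) →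
      ∀ e, (x0 - e) ^ 2 + m ^ 2 ≤ 8 * X e ^ 2 := by
    intro m hm hm3 hnear e
    rw [← sq_abs (x0 - e)]
    rcases le_total |x0 - e| m with h | h
    · have := hnear e h
      have h6 : |x0 - e| ^ 2 ≤ m ^ 2 := by gcongr
      have h7 : (m / 2) ^ 2 ≤ X e ^ 2 := by gcongr
      nlinarith
    · have h5 := hfar e (hm3.trans (by gcongr))
      have h6 : m ^ 2 ≤ |x0 - e| ^ 2 := by gcongr
      have h7 : (|x0 - e| / 2) ^ 2 ≤ X e ^ 2 := by gcongr
      nlinarith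
  have hpois : ∀ m, 0 < m → ∫ q in T3, 1 / ((x0 - edisp q) ^ 2 + m ^ 2) ≤ (r + K * m ^ (1/4 : ℝ)) / m := by
    intro m hm
    rw [poisson m x0 hm]
    gcongr
    have h5 := (Complex.abs_im_le_norm _).trans (h3 m x0 hm)
    rw [Complex.sub_im] at h5
    have := (abs_le.1 h5).1
    linarith
  by_cases hc : 16 * K ^ 4 * lam ^ 2 ≤ r ^ 3
  · have hrpos : 0 < r := by
      rcases hr0.eq_or_lt with h | h
      · rw [← h] at hc
        have : 0 < 16 * K ^ 4 * lam ^ 2 := by positivity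
        norm_num at hc
        linarith
      · exact h
    have hq := quarter K (lam ^ 2 * r) r (by linarith) (by positivity) hr0 (by
      calc _ = (16 * K ^ 4 * lam ^ 2) * r := by ring
        _ ≤ r ^ 3 * r := by gcongr
        _ = _ := by ring)
    refine ⟨lam ^ 2 * r, by positivity, hasm _ (by positivity) ?_ ?_, ?_⟩
    · calc 16 * K ^ 4 * lam ^ 8 = (16 * K ^ 4 * lam ^ 2) * lam ^ 6 := by ring
        _ ≤ r ^ 3 * lam ^ 6 := by gcongr
        _ = _ := by ring
    · intro e he
      have hd : |(Θ x0).im - (Θ e).im| ≤ K * |x0 - e| ^ (1/4 : ℝ) := by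
        rw [← Complex.sub_im]
        exact (Complex.abs_im_le_norm _).trans (h2 x0 e)
      have : K * |x0 - e| ^ (1/4 : ℝ) ≤ K * (lam ^ 2 * r) ^ (1/4 : ℝ) := by gcongr
      have h5 : r / 2 ≤ -(Θ e).im := by
        have := (abs_le.1 hd).1
        linarith
      have : lam ^ 2 * (r / 2) ≤ lam ^ 2 * -(Θ e).im := by gcongr
      linarith [hX2 e]
    · have := hpois (lam ^ 2 * r) (by positivity)
      calc _ ≤ 8 * ((r + K * (lam ^ 2 * r) ^ (1/4 : ℝ)) / (lam ^ 2 * r)) := by gcongr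
        _ ≤ 8 * ((r + r / 2) / (lam ^ 2 * r)) := by gcongr
        _ = 8 * (3 / 2) / lam ^ 2 := by field_simp; ring
        _ ≤ _ := by gcongr; linarith
  · push Not at hc
    have hη8 : lam ^ 8 ≤ η ^ 3 := by
      calc lam ^ 8 ≤ lam ^ 7 := pow_le_pow_of_le_one hl0.le hlam1 (by norm_num)
        _ ≤ _ := hη
    refine ⟨η, hη0, hasm _ hη0 ?_ ?_, ?_⟩
    · calc 16 * K ^ 4 * lam ^ 8 = (16 * K ^ 4 * lam) * lam ^ 7 := by ring
        _ ≤ 1 * η ^ 3 := by gcongr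
        _ = _ := by ring
    · intro e _
      have : 0 ≤ lam ^ 2 * -(Θ e).im := mul_nonneg (sq_nonneg _) (h4 e)
      linarith [hX2 e]
    · have := hpois η hη0
      have hr' : lam ^ 2 * r ≤ 16 * K ^ 4 * η := by
        rw [← pow_le_pow_iff_left₀ (by positivity) (by positivity) (by norm_num : (3:ℕ) ≠ 0)]
        calc (lam ^ 2 * r) ^ 3 = lam ^ 6 * r ^ 3 := by ring
          _ ≤ lam ^ 6 * (16 * K ^ 4 * lam ^ 2) := by gcongr
          _ = (16 * K ^ 4) * lam ^ 8 := by ring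
          _ ≤ (16 * K ^ 4) ^ 3 * η ^ 3 := by
            gcongr
            exact le_self_pow₀ (by linarith) (by norm_num)
          _ = _ := by ring
      have hη' : lam ^ 2 * η ^ (1/4 : ℝ) ≤ η := by
        have := quarter (lam ^ 2) η (2 * η) (by positivity) hη0.le (by positivity) (by
          calc 16 * (lam ^ 2) ^ 4 * η = 16 * lam ^ 8 * η := by ring
            _ ≤ 16 * η ^ 3 * η := by gcongr
            _ = _ := by ring)
        linarith
      calc _ ≤ 8 * ((r + K * η ^ (1/4 : ℝ)) / η) := by gcongr
        _ = 8 * (lam ^ 2 * r + K * (lam ^ 2 * η ^ (1/4 : ℝ))) / η / lam ^ 2 := by field_simp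
        _ ≤ 8 * (16 * K ^ 4 * η + K * η) / η / lam ^ 2 := by gcongr
        _ = _ := by field_simp

theorem statement6 (κ a : ℝ) (hκ0 : 0 < κ) (hκ : κ ≤ 1/12) (ha0 : 0 ≤ a) (ha : a < 1) :
    ∃ C lam0 : ℝ, 0 < C ∧ 0 < lam0 ∧
      ∀ Θ : ℝ → ℂ, IsThetaLimit Θ →
        ∀ lam : ℝ, 0 < lam → lam ≤ lam0 →
          ∀ η : ℝ, lam ^ (2 + 4 * κ) ≤ η → η ≤ lam ^ 2 →
            ∀ α : ℝ,
              (∫ p in T3, 1 / ‖(α : ℂ) - omegaR Θ lam p + (η : ℂ) * Complex.I‖ ^ (2 - a)) ≤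
                C * lam ^ (-(2 * (1 - a))) := by
  obtain ⟨K, hK, hM, hH⟩ := Theta_est
  have hK4 : 1 ≤ K ^ 4 := one_le_pow₀ hK
  have h2a : (2:ℝ) ^ (a - 1) < 1 := Real.rpow_lt_one_of_one_lt_of_neg (by norm_num) (by linarith)
  have h2a' : 0 < 1 - (2:ℝ) ^ (a - 1) := by linarith
  refine ⟨8 * (16 * K ^ 4 + K) + (1 + 2 * K) ^ 2 * (4 * K / (1 - 2 ^ (a - 1))), 1 / (16 * K ^ 4), by positivity, by positivity, ?_⟩
  intro Θ hΘ lam hl0 hl η hη1 hη2 α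
  obtain ⟨h1, h2, h3, h4⟩ := theta_lim K hK hM hH Θ hΘ
  have hl16 : 16 * K ^ 4 * lam ≤ 1 := by
    rw [le_div_iff₀ (by positivity)] at hl; linarith
  have hlam1 : lam ≤ 1 := by nlinarith
  have hη0 : 0 < η := lt_of_lt_of_le (by positivity) hη1
  have hη7 : lam ^ 7 ≤ η ^ 3 := by
    calc lam ^ 7 = (lam ^ (7/3 : ℝ)) ^ 3 := by
          rw [← Real.rpow_natCast, ← Real.rpow_natCast, ← Real.rpow_mul hl0.le]; norm_num
      _ ≤ (lam ^ (2 + 4 * κ)) ^ 3 := by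
          have := Real.rpow_le_rpow_of_exponent_ge hl0 hlam1 (by linarith : 2 + 4 * κ ≤ 7/3)
          gcongr
      _ ≤ _ := by gcongr
  obtain ⟨x0, hx0⟩ := surj K lam Θ h1 h2 α
  set X : ℝ → ℝ := fun e => ‖(α : ℂ) - ((e : ℂ) + (lam : ℂ) ^ 2 * Θ e) + (η : ℂ) * Complex.I‖ with hX
  have hX1 : ∀ e, |(x0 + lam ^ 2 * (Θ x0).re) - (e + lam ^ 2 * (Θ e).re)| ≤ X e := by
    intro e
    rw [hx0]
    have := Complex.abs_re_le_norm ((α : ℂ) - ((e : ℂ) + (lam : ℂ) ^ 2 * Θ e) + (η : ℂ) * Complex.I)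
    rw [← Complex.ofReal_pow] at this
    simp only [Complex.add_re, Complex.sub_re, Complex.re_ofReal_mul, Complex.ofReal_re, Complex.I_re, mul_zero, add_zero] at this
    rw [hX]; simp only; rw [← Complex.ofReal_pow]; exact this
  have hX2 : ∀ e, lam ^ 2 * (-(Θ e).im) + η ≤ X e := by
    intro e
    have := Complex.abs_im_le_norm ((α : ℂ) - ((e : ℂ) + (lam : ℂ) ^ 2 * Θ e) + (η : ℂ) * Complex.I)
    rw [← Complex.ofReal_pow] at this
    simp only [Complex.add_im, Complex.sub_im, Complex.im_ofReal_mul, Complex.ofReal_im, Complex.I_im, mul_one, zero_sub, zero_add] at this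
    have h := (le_abs_self _).trans this
    rw [hX]; simp only; rw [← Complex.ofReal_pow]; linarith
  obtain ⟨m, hm0, hm1, hm2⟩ := core K hK Θ h2 h3 h4 lam η x0 hl0 hl16 hη0 hη7 X hX1 hX2
  have hXη : ∀ e, η ≤ X e := fun e => by
    have := mul_nonneg (sq_nonneg lam) (h4 e)
    linarith [hX2 e]
  have hXpos : ∀ e, 0 < X e := fun e => hη0.trans_le (hXη e)
  have hl2 : 0 < lam ^ 2 := by positivity
  have hpt : ∀ e, 1 / X e ^ (2 - a) ≤ (lam ^ 2) ^ a * (8 * (1 / ((x0 - e) ^ 2 + m ^ 2)))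
      + (1 + 2 * K) ^ 2 * (1 / (max |x0 - e| (lam ^ 2)) ^ (2 - a)) := by
    intro e
    have hXe := hXpos e
    have hmax : 0 < max |x0 - e| (lam ^ 2) := lt_max_of_lt_right hl2
    rcases le_total (X e) (lam ^ 2) with h | h
    · have t2 : 0 ≤ (1 + 2 * K) ^ 2 * (1 / (max |x0 - e| (lam ^ 2)) ^ (2 - a)) := by positivity
      have t1 : 1 / X e ^ (2 - a) ≤ (lam ^ 2) ^ a * (8 * (1 / ((x0 - e) ^ 2 + m ^ 2))) := by
        rw [Real.rpow_sub hXe, Real.rpow_two, one_div_div, div_eq_mul_one_div]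
        have : 1 / X e ^ 2 ≤ 8 * (1 / ((x0 - e) ^ 2 + m ^ 2)) := by
          rw [mul_one_div, div_le_div_iff₀ (by positivity) (by positivity)]
          linarith [hm1 e]
        gcongr
      linarith
    · have t1 : 0 ≤ (lam ^ 2) ^ a * (8 * (1 / ((x0 - e) ^ 2 + m ^ 2))) := by positivity
      have t2 : 1 / X e ^ (2 - a) ≤ (1 + 2 * K) ^ 2 * (1 / (max |x0 - e| (lam ^ 2)) ^ (2 - a)) := by
        have hb : ∀ x, |(Θ x).re| ≤ K := fun x => (Complex.abs_re_le_norm _).trans (h1 x)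
        have hs : |x0 - e| ≤ (1 + 2 * K) * X e := by
          have q1 := abs_le.1 (hb x0)
          have q2 := abs_le.1 (hb e)
          have q3 := abs_le.1 (hX1 e)
          have q4 : lam ^ 2 * K ≤ X e * K := by gcongr
          rw [abs_le]
          constructor <;> nlinarith
        have hmx : max |x0 - e| (lam ^ 2) ≤ (1 + 2 * K) * X e := by
          apply max_le hs
          nlinarith
        rw [mul_one_div, div_le_div_iff₀ (by positivity) (by positivity), one_mul]
        calc (max |x0 - e| (lam ^ 2)) ^ (2 - a) ≤ ((1 + 2 * K) * X e) ^ (2 - a) := by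
              gcongr
              linarith
          _ = (1 + 2 * K) ^ (2 - a) * X e ^ (2 - a) := Real.mul_rpow (by positivity) hXe.le
          _ ≤ (1 + 2 * K) ^ 2 * X e ^ (2 - a) := by
              gcongr
              rw [← Real.rpow_two]
              exact Real.rpow_le_rpow_of_exponent_le (by linarith) (by linarith)
      linarith
  have hce := continuous_edisp
  have i1 := ((poisson_int m x0 hm0).const_mul 8).const_mul ((lam ^ 2) ^ a)
  have i2 : Integrable (fun q => (1 + 2 * K) ^ 2 * (1 / (max |x0 - edisp q| (lam ^ 2)) ^ (2 - a))) (volume.restrict T3) := by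
    apply Integrable.const_mul
    apply ContinuousOn.integrableOn_compact T3_compact
    apply Continuous.continuousOn
    have hmax : ∀ q, 0 < max |x0 - edisp q| (lam ^ 2) := fun q => lt_max_of_lt_right hl2
    refine Continuous.div continuous_const ?_ (fun q => (Real.rpow_pos_of_pos (hmax q) _).ne')
    exact Continuous.rpow_const (by fun_prop) (fun q => Or.inl (hmax q).ne')
  have e1 : (lam ^ 2) ^ (a - 1) = lam ^ (-(2 * (1 - a))) := by
    rw [← Real.rpow_natCast, ← Real.rpow_mul hl0.le]; congr 1; push_cast; ring
  calc _ ≤ ∫ q in T3, ((lam ^ 2) ^ a * (8 * (1 / ((x0 - edisp q) ^ 2 + m ^ 2)))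
      + (1 + 2 * K) ^ 2 * (1 / (max |x0 - edisp q| (lam ^ 2)) ^ (2 - a))) := by
        apply integral_mono_of_nonneg
        · exact ae_of_all _ fun q => by positivity
        · exact i1.add i2
        · exact ae_of_all _ fun q => hpt (edisp q)
    _ = (lam ^ 2) ^ a * (8 * ∫ q in T3, 1 / ((x0 - edisp q) ^ 2 + m ^ 2))
      + (1 + 2 * K) ^ 2 * ∫ q in T3, 1 / (max |x0 - edisp q| (lam ^ 2)) ^ (2 - a) := by
        rw [integral_add i1 i2, integral_const_mul, integral_const_mul, integral_const_mul]
    _ ≤ (lam ^ 2) ^ a * ((8 * (16 * K ^ 4 + K)) / lam ^ 2)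
      + (1 + 2 * K) ^ 2 * (4 * K / (1 - 2 ^ (a - 1)) * (lam ^ 2) ^ (a - 1)) := by
        gcongr
        exact far_integral K hK hM a ha0 ha (lam ^ 2) x0 hl2
    _ = _ := by
        rw [← e1, Real.rpow_sub_one hl2.ne']
        ring

end
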